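/- arXiv:1503.08123 — 5 statements merged into one kernel-verified Lean document; each statement's English description precedes it below -/
import Mathlib

section
/- Let T : F → A ⊆ ℝ^k be a functional. Let (Z, 𝒵) be a measurable space with a σ-finite measure ν ≠ 0, and let {S_z : z ∈ Z} be a family of strictly F-consistent scoring functions S_z : A × Ω → ℝ for T such that for all x ∈ A and F ∈ F the map (z,y) ↦ S_z(x,y) is jointly measurable and ν ⊗ F-integrable. Then S : A × Ω → ℝ defined by S(x,y) = ∫_Z S_z(x,y) ν(dz) is a strictly F-consistent scoring function for T. -/
open MeasureTheory Set

/-- A scoring function (with the required integrability) that is `𝓕`-consistent for `T`. -/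
def IsConsistentScoring {E X : Type*} [MeasurableSpace E]
    (𝓕 : Set (Measure E)) (A : Set X) (T : Measure E → X) (S : X → E → ℝ) : Prop :=
  (∀ μ ∈ 𝓕, ∀ x ∈ A, Integrable (S x) μ) ∧
  ∀ μ ∈ 𝓕, ∀ x ∈ A, (∫ y, S (T μ) y ∂μ) ≤ ∫ y, S x y ∂μ

/-- A strictly `𝓕`-consistent scoring function for `T`. -/
def IsStrictlyConsistentScoring {E X : Type*} [MeasurableSpace E]
    (𝓕 : Set (Measure E)) (A : Set X) (T : Measure E → X) (S : X → E → ℝ) : Prop :=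
  IsConsistentScoring 𝓕 A T S ∧
  ∀ μ ∈ 𝓕, ∀ x ∈ A, (∫ y, S (T μ) y ∂μ) = (∫ y, S x y ∂μ) → x = T μ

/-- A mixture `S(x,y) = ∫_Z S_z(x,y) ν(dz)` of strictly `𝓕`-consistent
scoring functions with respect to a σ-finite measure `ν ≠ 0` is again strictly
`𝓕`-consistent, provided `(z,y) ↦ S_z(x,y)` is `ν ⊗ F`-integrable for all `x ∈ A`, `F ∈ 𝓕`. -/
theorem statement4 {E Z : Type*} [MeasurableSpace E] [MeasurableSpace Z] {k : ℕ}
    (𝓕 : Set (Measure E)) (hprob : ∀ μ ∈ 𝓕, IsProbabilityMeasure μ)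
    (A : Set (EuclideanSpace ℝ (Fin k)))
    (T : Measure E → EuclideanSpace ℝ (Fin k)) (hT : ∀ μ ∈ 𝓕, T μ ∈ A)
    (ν : Measure Z) [SigmaFinite ν] (hν : ν ≠ 0)
    (S : Z → EuclideanSpace ℝ (Fin k) → E → ℝ)
    (hS : ∀ z : Z, IsStrictlyConsistentScoring 𝓕 A T (S z))
    (hint : ∀ x ∈ A, ∀ μ ∈ 𝓕, Integrable (fun p : Z × E => S p.1 x p.2) (ν.prod μ)) :
    IsStrictlyConsistentScoring 𝓕 A T (fun x y => ∫ z, S z x y ∂ν) := by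
  have swap : ∀ μ ∈ 𝓕, ∀ x ∈ A,
      (∫ y, ∫ z, S z x y ∂ν ∂μ) = ∫ z, ∫ y, S z x y ∂μ ∂ν := by
    intro μ hμ x hx
    have := hprob μ hμ
    exact (integral_integral_swap (f := fun z y => S z x y) (hint x hx μ hμ)).symm
  have score_int : ∀ μ ∈ 𝓕, ∀ x ∈ A, Integrable (fun z => ∫ y, S z x y ∂μ) ν := by
    intro μ hμ x hx
    have := hprob μ hμ
    exact (hint x hx μ hμ).integral_prod_left
  refine ⟨⟨fun μ hμ x hx => ?_, fun μ hμ x hx => ?_⟩, fun μ hμ x hx heq => ?_⟩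
  · have := hprob μ hμ
    exact (hint x hx μ hμ).integral_prod_right
  · rw [swap μ hμ x hx, swap μ hμ _ (hT μ hμ)]
    exact integral_mono (score_int μ hμ _ (hT μ hμ)) (score_int μ hμ x hx)
      fun z => (hS z).1.2 μ hμ x hx
  · rw [swap μ hμ x hx, swap μ hμ _ (hT μ hμ)] at heq
    have hae := (integral_eq_iff_of_ae_le (score_int μ hμ _ (hT μ hμ)) (score_int μ hμ x hx)
      (Filter.Eventually.of_forall fun z => (hS z).1.2 μ hμ x hx)).1 heq
    have : NeZero ν := ⟨hν⟩
    obtain ⟨z, hz⟩ := hae.exists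
    exact (hS z).2 μ hμ x hx hz
end

section
/- Revelation principle for identification functions: let g : A → A' be a bijection between A, A' ⊆ ℝ^k with inverse g^{-1}, and let T : F → A be a functional. Then V : A × Ω → ℝ^k is a strict F-identification function for T if and only if V_g : A' × Ω → ℝ^k defined by V_g(x',y) = V(g^{-1}(x'),y) is a strict F-identification function for T_g = g ∘ T. In particular, T is identifiable (admits a strict F-identification function) if and only if T_g is identifiable. -/
open MeasureTheory Set

/-- A strict `𝓕`-identification function for `T : 𝓕 → A ⊆ ℝᵏ` (including the required
integrability): `V̄(x,F) = 0 ↔ x = T(F)` for all `F ∈ 𝓕`, `x ∈ A`. -/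
def IsStrictIdentification {E : Type*} [MeasurableSpace E] {k : ℕ}
    (𝓕 : Set (Measure E)) (A : Set (EuclideanSpace ℝ (Fin k)))
    (T : Measure E → EuclideanSpace ℝ (Fin k))
    (V : EuclideanSpace ℝ (Fin k) → E → EuclideanSpace ℝ (Fin k)) : Prop :=
  (∀ μ ∈ 𝓕, ∀ x ∈ A, Integrable (V x) μ) ∧
  ∀ μ ∈ 𝓕, ∀ x ∈ A, ((∫ y, V x y ∂μ) = 0 ↔ x = T μ)

/-- Strict identification functions that correspond under a bijection `g : A → A'` identify `T` and
`g ∘ T` respectively. -/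
theorem isStrictIdentification_iff_of_bijOn {E : Type*} [MeasurableSpace E] {k : ℕ}
    {𝓕 : Set (Measure E)} {A A' : Set (EuclideanSpace ℝ (Fin k))}
    {g : EuclideanSpace ℝ (Fin k) → EuclideanSpace ℝ (Fin k)} (hbij : Set.BijOn g A A')
    {T : Measure E → EuclideanSpace ℝ (Fin k)} (hT : ∀ μ ∈ 𝓕, T μ ∈ A)
    {V W : EuclideanSpace ℝ (Fin k) → E → EuclideanSpace ℝ (Fin k)}
    (hVW : ∀ x ∈ A, W (g x) = V x) :
    IsStrictIdentification 𝓕 A T V ↔ IsStrictIdentification 𝓕 A' (fun μ => g (T μ)) W := by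
  unfold IsStrictIdentification
  rw [← hbij.image_eq]
  simp only [Set.forall_mem_image]
  refine and_congr ?_ ?_
  · refine forall₂_congr fun μ _ => forall₂_congr fun x hx => ?_
    rw [hVW x hx]
  · refine forall₂_congr fun μ hμ => forall₂_congr fun x hx => ?_
    rw [hVW x hx, hbij.injOn.eq_iff hx (hT μ hμ)]

/-- **revelation principle for identification functions.** For a bijection
`g : A → A'` with inverse `g⁻¹`, `V` is a strict `𝓕`-identification function for `T` iff
`V_g(x',y) = V(g⁻¹(x'),y)` is a strict `𝓕`-identification function for `T_g = g ∘ T`.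
In particular, `T` is identifiable iff `T_g` is identifiable. -/
theorem statement5 {E : Type*} [MeasurableSpace E] {k : ℕ}
    (𝓕 : Set (Measure E)) (hprob : ∀ μ ∈ 𝓕, IsProbabilityMeasure μ)
    (A A' : Set (EuclideanSpace ℝ (Fin k)))
    (g ginv : EuclideanSpace ℝ (Fin k) → EuclideanSpace ℝ (Fin k))
    (hbij : Set.BijOn g A A') (hinv : Set.InvOn ginv g A A')
    (T : Measure E → EuclideanSpace ℝ (Fin k)) (hT : ∀ μ ∈ 𝓕, T μ ∈ A)
    (V : EuclideanSpace ℝ (Fin k) → E → EuclideanSpace ℝ (Fin k)) :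
    (IsStrictIdentification 𝓕 A T V ↔
      IsStrictIdentification 𝓕 A' (fun μ => g (T μ)) (fun x' y => V (ginv x') y)) ∧
    ((∃ W, IsStrictIdentification 𝓕 A T W) ↔
      ∃ W', IsStrictIdentification 𝓕 A' (fun μ => g (T μ)) W') := by
  refine ⟨isStrictIdentification_iff_of_bijOn hbij hT fun x hx => ?_, ?_, ?_⟩
  · simp only [hinv.1 hx]
  · rintro ⟨W, hW⟩
    refine ⟨fun x' => W (ginv x'),
      (isStrictIdentification_iff_of_bijOn hbij hT fun x hx => ?_).1 hW⟩
    simp only [hinv.1 hx]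
  · rintro ⟨W', hW'⟩
    exact ⟨fun x => W' (g x),
      (isStrictIdentification_iff_of_bijOn hbij hT fun _ _ => rfl).2 hW'⟩
end

section
/- Convexity of level sets (Osband): let T : F → A ⊆ ℝ^k be an elicitable functional. Then for all F_0, F_1 ∈ F with t := T(F_0) = T(F_1) and for all λ ∈ (0,1) such that the mixture F_λ := (1−λ)F_0 + λF_1 belongs to F, it holds that T(F_λ) = t. -/
open MeasureTheory Set

/-- The integral against a two-component mixture is the mixture of the integrals. -/
theorem integral_mixture {E : Type*} [MeasurableSpace E] {μ ν : Measure E} {f : E → ℝ}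
    (hμ : Integrable f μ) (hν : Integrable f ν) {a b : ℝ} (ha : 0 ≤ a) (hb : 0 ≤ b) :
    ∫ y, f y ∂(ENNReal.ofReal a • μ + ENNReal.ofReal b • ν) =
      a * ∫ y, f y ∂μ + b * ∫ y, f y ∂ν := by
  rw [integral_add_measure (hμ.smul_measure ENNReal.ofReal_ne_top)
    (hν.smul_measure ENNReal.ofReal_ne_top), integral_smul_measure, integral_smul_measure,
    ENNReal.toReal_ofReal ha, ENNReal.toReal_ofReal hb, smul_eq_mul, smul_eq_mul]

/-- **Osband: convexity of level sets.** Let `T : 𝓕 → A ⊆ ℝᵏ` be elicitable.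
For all `F₀, F₁ ∈ 𝓕` with `T F₀ = T F₁` and `λ ∈ (0,1)` such that the mixture
`F_λ = (1-λ) F₀ + λ F₁ ∈ 𝓕`, one has `T F_λ = T F₀`. -/
theorem statement7 {E : Type*} [MeasurableSpace E] {k : ℕ}
    (𝓕 : Set (Measure E)) (hprob : ∀ μ ∈ 𝓕, IsProbabilityMeasure μ)
    (A : Set (EuclideanSpace ℝ (Fin k)))
    (T : Measure E → EuclideanSpace ℝ (Fin k)) (hT : ∀ μ ∈ 𝓕, T μ ∈ A)
    (helic : ∃ S : EuclideanSpace ℝ (Fin k) → E → ℝ, IsStrictlyConsistentScoring 𝓕 A T S)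
    (F₀ F₁ : Measure E) (hF₀ : F₀ ∈ 𝓕) (hF₁ : F₁ ∈ 𝓕) (heq : T F₀ = T F₁)
    (lam : ℝ) (hlam : lam ∈ Set.Ioo (0 : ℝ) 1)
    (hmix : ENNReal.ofReal (1 - lam) • F₀ + ENNReal.ofReal lam • F₁ ∈ 𝓕) :
    T (ENNReal.ofReal (1 - lam) • F₀ + ENNReal.ofReal lam • F₁) = T F₀ := by
  obtain ⟨S, ⟨hint, hcons⟩, hstrict⟩ := helic
  have h0 : 0 ≤ 1 - lam := sub_nonneg.mpr hlam.2.le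
  have h1 : 0 ≤ lam := hlam.1.le
  have hle₀ := hcons F₀ hF₀ _ (hT _ hmix)
  have hle₁ := hcons F₁ hF₁ _ (hT _ hmix)
  rw [← heq] at hle₁
  refine (hstrict _ hmix _ (hT F₀ hF₀) ((hcons _ hmix _ (hT F₀ hF₀)).antisymm ?_)).symm
  rw [integral_mixture (hint F₀ hF₀ _ (hT F₀ hF₀)) (hint F₁ hF₁ _ (hT F₀ hF₀)) h0 h1,
    integral_mixture (hint F₀ hF₀ _ (hT _ hmix)) (hint F₁ hF₁ _ (hT _ hmix)) h0 h1]
  gcongr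
end

section
/- Let F be a class of Borel probability distributions on ℝ with finite second moments. Then the functional T = (T_1,T_2) : F → ℝ^2 defined by T_1(F) = ∫ y dF(y) and T_2(F) = ∫ y^2 dF(y) − (∫ y dF(y))^2, i.e., the pair (mean, variance), is 2-elicitable. -/
open MeasureTheory Set

theorem integral_meanVarianceScore {μ : Measure ℝ} [IsProbabilityMeasure μ]
    (h : Integrable (fun y : ℝ => y ^ 2) μ) (a q : ℝ) :
    Integrable (fun y : ℝ => (a ^ 2 + q ^ 2) - 2 * a * y - 2 * q * y ^ 2) μ ∧
    ∫ y, ((a ^ 2 + q ^ 2) - 2 * a * y - 2 * q * y ^ 2) ∂μ =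
      (a - ∫ y, y ∂μ) ^ 2 + (q - ∫ y, y ^ 2 ∂μ) ^ 2
        - ((∫ y, y ∂μ) ^ 2 + (∫ y, y ^ 2 ∂μ) ^ 2) := by
  have hy : Integrable (fun y : ℝ => y) μ :=
    ((memLp_two_iff_integrable_sq aestronglyMeasurable_id).2 h).integrable one_le_two
  have hc : Integrable (fun _ : ℝ => a ^ 2 + q ^ 2) μ := integrable_const _
  have ha := hy.const_mul (2 * a)
  have hq := h.const_mul (2 * q)
  have hca : Integrable (fun y : ℝ => (a ^ 2 + q ^ 2) - 2 * a * y) μ := hc.sub ha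
  refine ⟨hca.sub hq, ?_⟩
  rw [integral_sub hca hq, integral_sub hc ha, integral_const_mul, integral_const_mul,
    integral_const, probReal_univ, one_smul]
  ring

/-- For any class `𝓕` of Borel probability distributions on `ℝ` with finite
second moments, the pair (mean, variance), i.e. `T(F) = (∫ y dF, ∫ y² dF − (∫ y dF)²)`,
is 2-elicitable. -/
theorem statement9
    (𝓕 : Set (Measure ℝ)) (hprob : ∀ μ ∈ 𝓕, IsProbabilityMeasure μ)
    (hmom : ∀ μ ∈ 𝓕, Integrable (fun y : ℝ => y ^ 2) μ)
    (T : Measure ℝ → ℝ × ℝ)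
    (hT : ∀ μ ∈ 𝓕, T μ = (∫ y, y ∂μ, (∫ y, y ^ 2 ∂μ) - (∫ y, y ∂μ) ^ 2)) :
    ∃ S : ℝ × ℝ → ℝ → ℝ, IsStrictlyConsistentScoring 𝓕 Set.univ T S := by
  let S : ℝ × ℝ → ℝ → ℝ := fun x y =>
    (x.1 ^ 2 + (x.2 + x.1 ^ 2) ^ 2) - 2 * x.1 * y - 2 * (x.2 + x.1 ^ 2) * y ^ 2
  have key (μ) (hμ : μ ∈ 𝓕) (x : ℝ × ℝ) : Integrable (S x) μ ∧
      ∫ y, S x y ∂μ = (∫ y, S (T μ) y ∂μ) +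
        ((x.1 - (T μ).1) ^ 2 + (x.2 + x.1 ^ 2 - ((T μ).2 + (T μ).1 ^ 2)) ^ 2) := by
    have := hprob μ hμ
    have hS (z : ℝ × ℝ) := integral_meanVarianceScore (hmom μ hμ) z.1 (z.2 + z.1 ^ 2)
    refine ⟨(hS x).1, ?_⟩
    rw [(hS x).2, (hS (T μ)).2, hT μ hμ]
    ring
  refine ⟨S, ⟨fun μ hμ x _ => (key μ hμ x).1, fun μ hμ x _ => ?_⟩, fun μ hμ x _ hx => ?_⟩
  · rw [(key μ hμ x).2]
    exact le_add_of_nonneg_right (add_nonneg (sq_nonneg _) (sq_nonneg _))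
  · rw [(key μ hμ x).2] at hx
    have h1 : x.1 = (T μ).1 := by
      nlinarith [sq_nonneg (x.1 - (T μ).1),
        sq_nonneg (x.2 + x.1 ^ 2 - ((T μ).2 + (T μ).1 ^ 2))]
    refine Prod.ext h1 ?_
    rw [h1] at hx
    nlinarith [sq_nonneg (x.2 - (T μ).2)]
end

section
/- Joint elicitability of (Value at Risk, Expected Shortfall): let α ∈ (0,1) and let F be a class of distribution functions on ℝ with finite first moments and unique α-quantiles, and let A_0 = {(x_1,x_2) ∈ ℝ^2 : x_1 ≥ x_2}. Define T : F → A_0 by T(F) = (VaR_α(F), ES_α(F)) = (F^{-1}(α), (1/α)∫_0^α F^{-1}(u) du). Let G_1, G_2, 𝒢_2, a : ℝ → ℝ with 𝒢_2' = G_2, a F-integrable and 1_{(−∞,x_1]}·G_1 F-integrable for all x_1 ∈ ℝ, and define S : A_0 × ℝ → ℝ by S(x_1,x_2,y) = (1{y ≤ x_1} − α) G_1(x_1) − 1{y ≤ x_1} G_1(y) + G_2(x_2) ( x_2 − x_1 + (1/α) 1{y ≤ x_1}(x_1 − y) ) − 𝒢_2(x_2) + a(y). If G_1 is increasing and 𝒢_2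 is increasing and convex, then S is F-consistent for T. If moreover 𝒢_2 is strictly increasing and strictly convex, then S is strictly F-consistent for T; in particular, the pair (VaR_α, ES_α) is 2-elicitable relative to F. -/
open MeasureTheory Set

/-- The cumulative distribution function of `μ`. -/
noncomputable def cdf (μ : Measure ℝ) (x : ℝ) : ℝ := (μ (Set.Iic x)).toReal

/-- The left limit `lim_{z↑x} F(z)` of the cdf of `μ`. -/
noncomputable def cdfLeft (μ : Measure ℝ) (x : ℝ) : ℝ := (μ (Set.Iio x)).toReal

/-- The (generalized) `p`-quantile `F⁻¹(p) = inf {x : p ≤ F(x)}`, i.e. `VaR_p`. -/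
noncomputable def quantile (μ : Measure ℝ) (p : ℝ) : ℝ := sInf {x : ℝ | p ≤ cdf μ x}

/-- Expected Shortfall at level `α`: `ES_α(F) = α⁻¹ ∫_0^α F⁻¹(u) du`. -/
noncomputable def es (μ : Measure ℝ) (α : ℝ) : ℝ := (1 / α) * ∫ u in (0 : ℝ)..α, quantile μ u

/-- `μ` has a unique `p`-quantile: `{x : lim_{z↑x}F(z) ≤ p ≤ F(x)}` is a singleton. -/
def UniqueQuantile (μ : Measure ℝ) (p : ℝ) : Prop :=
  ∃ c : ℝ, {x : ℝ | cdfLeft μ x ≤ p ∧ p ≤ cdf μ x} = {c}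

/-- The scoring function for the pair `(VaR_α, ES_α)` of Fissler–Ziegel, Corollary 5.5. -/
noncomputable def varEsScore (α : ℝ) (G₁ G₂ 𝒢₂ a : ℝ → ℝ) (x : ℝ × ℝ) (y : ℝ) : ℝ :=
  ((if y ≤ x.1 then (1 : ℝ) else 0) - α) * G₁ x.1
    - (if y ≤ x.1 then (1 : ℝ) else 0) * G₁ y
    + G₂ x.2 * (x.2 - x.1 + (1 / α) * (if y ≤ x.1 then (1 : ℝ) else 0) * (x.1 - y))
    - 𝒢₂ x.2 + a y

/-- The generalized piecewise linear score, which elicits the `α`-quantile. -/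
noncomputable def quantileScore (α : ℝ) (G : ℝ → ℝ) (x y : ℝ) : ℝ :=
  ((if y ≤ x then (1 : ℝ) else 0) - α) * G x - (if y ≤ x then (1 : ℝ) else 0) * G y

lemma cdf_eq_stieltjes (μ : Measure ℝ) [IsProbabilityMeasure μ] (x : ℝ) :
    cdf μ x = ProbabilityTheory.cdf μ x :=
  (ProbabilityTheory.cdf_eq_real μ x).symm

lemma cdf_mono (μ : Measure ℝ) [IsProbabilityMeasure μ] : Monotone (cdf μ) := fun _ _ h =>
  measureReal_mono (μ := μ) (Iic_subset_Iic.2 h)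

lemma cdfLeft_le_cdf (μ : Measure ℝ) [IsProbabilityMeasure μ] (x : ℝ) :
    cdfLeft μ x ≤ cdf μ x :=
  measureReal_mono (μ := μ) Iio_subset_Iic_self

lemma cdf_le_cdfLeft (μ : Measure ℝ) [IsProbabilityMeasure μ] {x z : ℝ} (h : x < z) :
    cdf μ x ≤ cdfLeft μ z :=
  measureReal_mono (μ := μ) (Iic_subset_Iio.2 h)

lemma quantile_le_iff (μ : Measure ℝ) [IsProbabilityMeasure μ] {p : ℝ} (hp : p ∈ Ioo (0 : ℝ) 1)
    (x : ℝ) : quantile μ p ≤ x ↔ p ≤ cdf μ x := by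
  have hbdd : BddBelow {x : ℝ | p ≤ cdf μ x} := by
    obtain ⟨b, hb⟩ :=
      ((ProbabilityTheory.tendsto_cdf_atBot μ).eventually_lt_const hp.1).exists
    refine ⟨b, fun z hz => ?_⟩
    by_contra! hzb
    rw [← cdf_eq_stieltjes] at hb
    exact (hb.trans_le hz).not_ge (cdf_mono μ hzb.le)
  have hne : {x : ℝ | p ≤ cdf μ x}.Nonempty := by
    obtain ⟨b, hb⟩ :=
      ((ProbabilityTheory.tendsto_cdf_atTop μ).eventually_const_lt hp.2).exists
    rw [← cdf_eq_stieltjes] at hb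
    exact ⟨b, hb.le⟩
  refine ⟨fun h => ?_, fun h => csInf_le hbdd h⟩
  have hcont := ((ProbabilityTheory.cdf μ).right_continuous x).mono Ioi_subset_Ici_self
  rw [cdf_eq_stieltjes]
  refine ge_of_tendsto hcont ?_
  filter_upwards [self_mem_nhdsWithin] with z hz
  obtain ⟨w, hw, hwz⟩ := exists_lt_of_csInf_lt hne (lt_of_le_of_lt h hz)
  rw [← cdf_eq_stieltjes]
  exact le_trans hw (cdf_mono μ hwz.le)

lemma quantile_monotoneOn (μ : Measure ℝ) [IsProbabilityMeasure μ] :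
    MonotoneOn (quantile μ) (Ioo 0 1) := fun _ hp _ hr h =>
  (quantile_le_iff μ hp _).2 (h.trans ((quantile_le_iff μ hr _).1 le_rfl))

lemma aemeasurable_quantile (μ : Measure ℝ) [IsProbabilityMeasure μ] :
    AEMeasurable (quantile μ) (volume.restrict (Ioo (0 : ℝ) 1)) :=
  aemeasurable_restrict_of_monotoneOn measurableSet_Ioo (quantile_monotoneOn μ)

/-- The quantile transform: the quantile function pushes the uniform law forward to `μ`. -/
lemma map_quantile (μ : Measure ℝ) [IsProbabilityMeasure μ] :
    (volume.restrict (Ioo (0 : ℝ) 1)).map (quantile μ) = μ := by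
  have : IsFiniteMeasure ((volume.restrict (Ioo (0 : ℝ) 1)).map (quantile μ)) := by
    infer_instance
  refine Measure.ext_of_Iic _ _ fun x => ?_
  rw [Measure.map_apply_of_aemeasurable (aemeasurable_quantile μ) measurableSet_Iic,
    Measure.restrict_apply₀' measurableSet_Ioo.nullMeasurableSet]
  have hset : quantile μ ⁻¹' Iic x ∩ Ioo 0 1 = Iic (cdf μ x) ∩ Ioo 0 1 := by
    ext p
    simp only [mem_inter_iff, mem_preimage, mem_Iic]
    exact and_congr_left fun hp => quantile_le_iff μ hp x
  have hle : cdf μ x ≤ 1 := measureReal_le_one (μ := μ)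
  have h1 : (Iic (cdf μ x) ∩ Ioo 0 1 : Set ℝ) =ᵐ[volume] (Ioc 0 (cdf μ x) : Set ℝ) := by
    have h2 : (Iic (cdf μ x) ∩ Ioc 0 1 : Set ℝ) = Ioc 0 (cdf μ x) := by
      ext p
      simp only [mem_inter_iff, mem_Iic, mem_Ioc]
      exact ⟨fun h => ⟨h.2.1, h.1⟩, fun h => ⟨h.2, h.1, h.2.trans hle⟩⟩
    rw [← h2]
    exact (Filter.EventuallyEq.refl _ _).inter Ioo_ae_eq_Ioc
  rw [hset, measure_congr h1, Real.volume_Ioc, sub_zero]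
  exact ENNReal.ofReal_toReal (measure_ne_top μ _)

/-- Expected Shortfall in terms of the lower partial moment below the quantile. -/
lemma mul_es_eq (μ : Measure ℝ) [IsProbabilityMeasure μ] (hmom : Integrable (fun y : ℝ => y) μ)
    {α : ℝ} (hα : α ∈ Ioo (0 : ℝ) 1) :
    α * es μ α = α * quantile μ α - ∫ y, max (quantile μ α - y) 0 ∂μ := by
  set q := quantile μ α
  have hae := aemeasurable_quantile μ
  have hint : IntegrableOn (quantile μ) (Ioo 0 1) := by
    have h := hmom
    rw [← map_quantile μ] at h
    exact (integrable_map_measure h.aestronglyMeasurable hae).1 h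
  have hpos : ∫ y, max (q - y) 0 ∂μ = ∫ u in Ioo (0 : ℝ) 1, max (q - quantile μ u) 0 := by
    conv_lhs => rw [← map_quantile μ]
    exact integral_map hae (by fun_prop)
  have hsub : Ioc 0 α ⊆ Ioo (0 : ℝ) 1 := fun u hu => ⟨hu.1, hu.2.trans_lt hα.2⟩
  have hrestr : ∫ u in Ioo (0 : ℝ) 1, max (q - quantile μ u) 0
      = ∫ u in Ioc 0 α, (q - quantile μ u) := by
    rw [setIntegral_eq_of_subset_of_forall_sdiff_eq_zero measurableSet_Ioo hsub]
    · refine setIntegral_congr_fun measurableSet_Ioc fun u hu => ?_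
      exact max_eq_left (sub_nonneg.2 (quantile_monotoneOn μ (hsub hu) hα hu.2))
    · rintro u ⟨hu, hu'⟩
      have hαu : α ≤ u := le_of_not_ge fun h => hu' ⟨hu.1, h⟩
      exact max_eq_right (sub_nonpos.2 (quantile_monotoneOn μ hα hu hαu))
  have hconst : ∫ _ in Ioc 0 α, q = α * q := by
    simp [hα.1.le]
  rw [hpos, hrestr, integral_sub (integrable_const _) (hint.mono_set hsub), hconst, es,
    intervalIntegral.integral_of_le hα.1.le]
  field_simp [hα.1.ne']
  ring

lemma quantile_mem_of_uniqueQuantile (μ : Measure ℝ) [IsProbabilityMeasure μ] {α : ℝ}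
    (hα : α ∈ Ioo (0 : ℝ) 1) (h : UniqueQuantile μ α) :
    {x : ℝ | cdfLeft μ x ≤ α ∧ α ≤ cdf μ x} = {quantile μ α} := by
  obtain ⟨c, hc⟩ := h
  have hmem : cdfLeft μ c ≤ α ∧ α ≤ cdf μ c := by
    have : c ∈ {x : ℝ | cdfLeft μ x ≤ α ∧ α ≤ cdf μ x} := hc ▸ mem_singleton c
    exact this
  have hle : quantile μ α ≤ c := (quantile_le_iff μ hα c).2 hmem.2
  have hq : α ≤ cdf μ (quantile μ α) := (quantile_le_iff μ hα _).1 le_rfl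
  have hqc : quantile μ α = c := by
    rcases hle.eq_or_lt with h | h
    · exact h
    · have : quantile μ α ∈ {x : ℝ | cdfLeft μ x ≤ α ∧ α ≤ cdf μ x} :=
        ⟨(cdfLeft_le_cdf μ _).trans ((cdf_le_cdfLeft μ h).trans hmem.1), hq⟩
      rw [hc] at this
      exact this
  rw [hc, hqc]

lemma integrable_ite_le (μ : Measure ℝ) [IsProbabilityMeasure μ] (x : ℝ) :
    Integrable (fun y : ℝ => if y ≤ x then (1 : ℝ) else 0) μ :=
  (integrable_const (1 : ℝ)).indicator (measurableSet_Iic (a := x)) |>.congr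
    (ae_of_all _ fun y => by simp [indicator_apply])

lemma integral_ite_le (μ : Measure ℝ) (x : ℝ) :
    ∫ y : ℝ, (if y ≤ x then (1 : ℝ) else 0) ∂μ = cdf μ x := by
  rw [cdf, ← Measure.real, ← integral_indicator_one measurableSet_Iic]
  exact integral_congr_ae (ae_of_all _ fun y => by simp [indicator_apply])

lemma integrable_ite_lt (μ : Measure ℝ) [IsProbabilityMeasure μ] (x : ℝ) :
    Integrable (fun y : ℝ => if y < x then (1 : ℝ) else 0) μ :=
  (integrable_const (1 : ℝ)).indicator (measurableSet_Iio (a := x)) |>.congr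
    (ae_of_all _ fun y => by simp [indicator_apply])

lemma integral_ite_lt (μ : Measure ℝ) (x : ℝ) :
    ∫ y : ℝ, (if y < x then (1 : ℝ) else 0) ∂μ = cdfLeft μ x := by
  rw [cdfLeft, ← Measure.real, ← integral_indicator_one measurableSet_Iio]
  exact integral_congr_ae (ae_of_all _ fun y => by simp [indicator_apply])

lemma integrable_quantileScore (μ : Measure ℝ) [IsProbabilityMeasure μ] (α : ℝ) {G : ℝ → ℝ}
    {x : ℝ} (hG : Integrable ((Iic x).indicator G) μ) :
    Integrable (quantileScore α G x) μ := by
  refine ((((integrable_ite_le μ x).sub (integrable_const α)).mul_const (G x)).sub hG).congr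
    (ae_of_all _ fun y => ?_)
  simp [quantileScore, indicator_apply]

/-- `cdf μ z - α` is a subgradient of the expected quantile score at `z`. -/
lemma add_cdf_le_integral_quantileScore (μ : Measure ℝ) [IsProbabilityMeasure μ] (α : ℝ)
    {G : ℝ → ℝ} (hmono : Monotone G) (hG : ∀ x, Integrable ((Iic x).indicator G) μ) (x z : ℝ) :
    (∫ y, quantileScore α G z y ∂μ) + (cdf μ z - α) * (G x - G z)
      ≤ ∫ y, quantileScore α G x y ∂μ := by
  have hz := integrable_quantileScore μ α (hG z)
  have hi : Integrable (fun y => ((if y ≤ z then (1 : ℝ) else 0) - α) * (G x - G z)) μ :=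
    ((integrable_ite_le μ z).sub (integrable_const α)).mul_const (G x - G z)
  have heq : (∫ y, quantileScore α G z y ∂μ) + (cdf μ z - α) * (G x - G z)
      = ∫ y, (quantileScore α G z y
          + ((if y ≤ z then (1 : ℝ) else 0) - α) * (G x - G z)) ∂μ := by
    rw [integral_add hz hi, integral_mul_const,
      integral_sub (integrable_ite_le μ z) (integrable_const α), integral_ite_le]
    simp
  rw [heq]
  refine integral_mono (hz.add hi) (integrable_quantileScore μ α (hG x)) fun y => ?_
  simp only [quantileScore]
  split_ifs with h1 h2 h2
  · linarith
  · linarith [hmono (not_le.1 h2).le]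
  · linarith [hmono h2]
  · linarith

/-- `cdfLeft μ z - α` is a subgradient of the expected quantile score at `z`. -/
lemma add_cdfLeft_le_integral_quantileScore (μ : Measure ℝ) [IsProbabilityMeasure μ] (α : ℝ)
    {G : ℝ → ℝ} (hmono : Monotone G) (hG : ∀ x, Integrable ((Iic x).indicator G) μ) (x z : ℝ) :
    (∫ y, quantileScore α G z y ∂μ) + (cdfLeft μ z - α) * (G x - G z)
      ≤ ∫ y, quantileScore α G x y ∂μ := by
  have hz := integrable_quantileScore μ α (hG z)
  have hi : Integrable (fun y => ((if y < z then (1 : ℝ) else 0) - α) * (G x - G z)) μ :=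
    ((integrable_ite_lt μ z).sub (integrable_const α)).mul_const (G x - G z)
  have heq : (∫ y, quantileScore α G z y ∂μ) + (cdfLeft μ z - α) * (G x - G z)
      = ∫ y, (quantileScore α G z y
          + ((if y < z then (1 : ℝ) else 0) - α) * (G x - G z)) ∂μ := by
    rw [integral_add hz hi, integral_mul_const,
      integral_sub (integrable_ite_lt μ z) (integrable_const α), integral_ite_lt]
    simp
  rw [heq]
  refine integral_mono (hz.add hi) (integrable_quantileScore μ α (hG x)) fun y => ?_
  simp only [quantileScore]
  rcases lt_trichotomy y z with h | rfl | h
  · rw [if_pos h.le, if_pos h]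
    split_ifs with h2
    · linarith
    · linarith [hmono (not_le.1 h2).le]
  · rw [if_pos le_rfl, if_neg (lt_irrefl y)]
    split_ifs with h2
    · linarith [hmono h2]
    · linarith
  · rw [if_neg h.not_ge, if_neg h.not_gt]
    split_ifs with h2
    · linarith [hmono h2]
    · linarith

lemma integral_quantileScore_le (μ : Measure ℝ) [IsProbabilityMeasure μ] {α q : ℝ}
    {G : ℝ → ℝ} (hmono : Monotone G) (hG : ∀ x, Integrable ((Iic x).indicator G) μ)
    (hleft : cdfLeft μ q ≤ α) (hright : α ≤ cdf μ q) (x : ℝ) :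
    (∫ y, quantileScore α G q y ∂μ) ≤ ∫ y, quantileScore α G x y ∂μ := by
  rcases le_total q x with h | h
  · have := add_cdf_le_integral_quantileScore μ α hmono hG x q
    nlinarith [mul_nonneg (sub_nonneg.2 hright) (sub_nonneg.2 (hmono h))]
  · have := add_cdfLeft_le_integral_quantileScore μ α hmono hG x q
    nlinarith [mul_nonneg (sub_nonneg.2 hleft) (sub_nonneg.2 (hmono h))]

lemma eq_of_integral_quantileScore_eq (μ : Measure ℝ) [IsProbabilityMeasure μ] {α q : ℝ}
    {G : ℝ → ℝ} (hmono : StrictMono G) (hG : ∀ x, Integrable ((Iic x).indicator G) μ)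
    (hq : {x : ℝ | cdfLeft μ x ≤ α ∧ α ≤ cdf μ x} = {q}) {x : ℝ}
    (hx : (∫ y, quantileScore α G q y ∂μ) = ∫ y, quantileScore α G x y ∂μ) : x = q := by
  have hmem : cdfLeft μ q ≤ α ∧ α ≤ cdf μ q := by
    have : q ∈ {x : ℝ | cdfLeft μ x ≤ α ∧ α ≤ cdf μ x} := hq ▸ mem_singleton q
    exact this
  have huniq : ∀ z, cdfLeft μ z ≤ α → α ≤ cdf μ z → z = q := fun z h1 h2 => by
    have : z ∈ {x : ℝ | cdfLeft μ x ≤ α ∧ α ≤ cdf μ x} := ⟨h1, h2⟩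
    rw [hq] at this
    exact this
  by_contra hne
  have hmin := integral_quantileScore_le μ hmono.monotone hG hmem.1 hmem.2
  rcases lt_or_gt_of_ne hne with h | h
  · obtain ⟨z, hxz, hzq⟩ := exists_between h
    have h1 := add_cdfLeft_le_integral_quantileScore μ α hmono.monotone hG x z
    have h2 : α ≤ cdfLeft μ z := by
      by_contra! hlt
      nlinarith [mul_pos (sub_pos.2 hlt) (sub_pos.2 (hmono hxz)), hmin z]
    exact hzq.ne (huniq z ((cdfLeft_le_cdf μ z).trans ((cdf_le_cdfLeft μ hzq).trans hmem.1))
      (h2.trans (cdfLeft_le_cdf μ z)))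
  · obtain ⟨z, hqz, hzx⟩ := exists_between h
    have h1 := add_cdf_le_integral_quantileScore μ α hmono.monotone hG x z
    have h2 : cdf μ z ≤ α := by
      by_contra! hlt
      nlinarith [mul_pos (sub_pos.2 hlt) (sub_pos.2 (hmono hzx)), hmin z]
    exact hqz.ne' (huniq z ((cdfLeft_le_cdf μ z).trans h2) (hmem.2.trans (cdf_mono μ hqz.le)))

/-- The expected quantile score with `G t = t / α`, at the quantile, is minus the Expected
Shortfall. -/
lemma integral_quantileScore_div (μ : Measure ℝ) [IsProbabilityMeasure μ]
    (hmom : Integrable (fun y : ℝ => y) μ) {α : ℝ} (hα : α ∈ Ioo (0 : ℝ) 1) :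
    ∫ y, quantileScore α (fun t => t / α) (quantile μ α) y ∂μ = -es μ α := by
  have h := mul_es_eq μ hmom hα
  set q := quantile μ α
  have hint : Integrable (fun y => max (q - y) 0) μ :=
    ((integrable_const q).sub hmom).pos_part
  have heq : ∀ y, quantileScore α (fun t => t / α) q y = (1 / α) * max (q - y) 0 - q := by
    intro y
    have hα0 := hα.1.ne'
    simp only [quantileScore]
    split_ifs with hy
    · rw [max_eq_left (sub_nonneg.2 hy)]
      field_simp
      ring
    · rw [max_eq_right (sub_nonpos.2 (not_le.1 hy).le)]
      field_simp
      ring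
  simp_rw [heq]
  rw [integral_sub (hint.const_mul _) (integrable_const q), integral_const_mul]
  have h2 : ∫ y, max (q - y) 0 ∂μ = α * (q - es μ α) := by linarith
  rw [h2]
  have hα0 := hα.1.ne'
  simp only [integral_const, probReal_univ, smul_eq_mul, one_mul]
  field_simp
  ring

lemma varEsScore_eq {α : ℝ} (hα : α ≠ 0) (G₁ G₂ 𝒢₂ a : ℝ → ℝ) (x : ℝ × ℝ) (y : ℝ) :
    varEsScore α G₁ G₂ 𝒢₂ a x y = quantileScore α G₁ x.1 y
      + G₂ x.2 * (x.2 + quantileScore α (fun t => t / α) x.1 y) - 𝒢₂ x.2 + a y := by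
  simp only [varEsScore, quantileScore]
  field_simp
  ring

lemma add_mul_sub_le_of_convexOn {f : ℝ → ℝ} {f' s : ℝ} (hf : ConvexOn ℝ univ f)
    (hd : HasDerivAt f f' s) (t : ℝ) : f s + f' * (t - s) ≤ f t := by
  rcases lt_trichotomy s t with h | rfl | h
  · have := hf.le_slope_of_hasDerivAt (mem_univ _) (mem_univ _) h hd
    rw [slope_def_field, le_div_iff₀ (sub_pos.2 h)] at this
    linarith
  · simp
  · have := hf.slope_le_of_hasDerivAt (mem_univ _) (mem_univ _) h hd
    rw [slope_def_field, div_le_iff₀ (sub_pos.2 h)] at this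
    linarith

lemma add_mul_sub_lt_of_strictConvexOn {f : ℝ → ℝ} {f' s t : ℝ} (hf : StrictConvexOn ℝ univ f)
    (hd : HasDerivAt f f' s) (hne : s ≠ t) : f s + f' * (t - s) < f t := by
  have h1 := add_mul_sub_le_of_convexOn hf.convexOn hd ((1 / 2 : ℝ) • s + (1 / 2 : ℝ) • t)
  have h2 := hf.2 (mem_univ s) (mem_univ t) hne (half_pos one_pos) (half_pos one_pos)
    (add_halves 1)
  simp only [smul_eq_mul] at h1 h2
  nlinarith

/-- **joint elicitability of (Value at Risk, Expected Shortfall).** For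
`α ∈ (0,1)`, a class `𝓕` of distributions on `ℝ` with finite first moments and unique
`α`-quantiles, `A₀ = {x : x₁ ≥ x₂}` and `T = (VaR_α, ES_α)`: if `G₁` is increasing and `𝒢₂`
is increasing and convex (with `𝒢₂' = G₂`), then the score `S` above is `𝓕`-consistent for
`T`; if moreover `𝒢₂` is strictly increasing and strictly convex, then `S` is strictly
`𝓕`-consistent for `T`; in particular, `(VaR_α, ES_α)` is 2-elicitable relative to `𝓕`. -/
theorem statement19 (α : ℝ) (hα : α ∈ Set.Ioo (0 : ℝ) 1)
    (𝓕 : Set (Measure ℝ)) (hprob : ∀ μ ∈ 𝓕, IsProbabilityMeasure μ)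
    (hmom : ∀ μ ∈ 𝓕, Integrable (fun y : ℝ => y) μ)
    (huniq : ∀ μ ∈ 𝓕, UniqueQuantile μ α)
    (T : Measure ℝ → ℝ × ℝ)
    (hT : ∀ μ ∈ 𝓕, T μ = (quantile μ α, es μ α))
    (hTA : ∀ μ ∈ 𝓕, T μ ∈ {x : ℝ × ℝ | x.2 ≤ x.1})
    (G₁ G₂ 𝒢₂ a : ℝ → ℝ)
    (h𝒢₂ : ∀ t : ℝ, HasDerivAt 𝒢₂ (G₂ t) t)
    (ha : ∀ μ ∈ 𝓕, Integrable a μ)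
    (hG₁int : ∀ x₁ : ℝ, ∀ μ ∈ 𝓕, Integrable (Set.indicator (Set.Iic x₁) G₁) μ)
    (hG₁ : Monotone G₁) (h𝒢₂mono : Monotone 𝒢₂) (h𝒢₂conv : ConvexOn ℝ Set.univ 𝒢₂) :
    IsConsistentScoring 𝓕 {x : ℝ × ℝ | x.2 ≤ x.1} T (varEsScore α G₁ G₂ 𝒢₂ a) ∧
    ((StrictMono 𝒢₂ ∧ StrictConvexOn ℝ Set.univ 𝒢₂) →
      IsStrictlyConsistentScoring 𝓕 {x : ℝ × ℝ | x.2 ≤ x.1} T (varEsScore α G₁ G₂ 𝒢₂ a) ∧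
      ∃ S' : ℝ × ℝ → ℝ → ℝ,
        IsStrictlyConsistentScoring 𝓕 {x : ℝ × ℝ | x.2 ≤ x.1} T S') := by
  have hα0 : α ≠ 0 := hα.1.ne'
  have hdivmono : StrictMono fun t : ℝ => t / α := fun s t h => div_lt_div_of_pos_right h hα.1
  have hdivint : ∀ μ ∈ 𝓕, ∀ x, Integrable ((Iic x).indicator fun t : ℝ => t / α) μ :=
    fun μ hμ x => ((hmom μ hμ).div_const α).indicator measurableSet_Iic
  have hG₂nonneg : ∀ t, 0 ≤ G₂ t := fun t => (h𝒢₂ t).nonneg_of_monotone h𝒢₂mono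
  have hint : ∀ μ ∈ 𝓕, ∀ x : ℝ × ℝ, Integrable (varEsScore α G₁ G₂ 𝒢₂ a x) μ := by
    intro μ hμ x
    have := hprob μ hμ
    have h1 := integrable_quantileScore μ α (hG₁int x.1 μ hμ)
    have h2 := integrable_quantileScore μ α (hdivint μ hμ x.1)
    exact (((h1.add (((integrable_const x.2).add h2).const_mul (G₂ x.2))).sub
      (integrable_const (𝒢₂ x.2))).add (ha μ hμ)).congr
      (ae_of_all _ fun y => (varEsScore_eq hα0 G₁ G₂ 𝒢₂ a x y).symm)
  have hval : ∀ μ ∈ 𝓕, ∀ x : ℝ × ℝ, ∫ y, varEsScore α G₁ G₂ 𝒢₂ a x y ∂μ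
      = (∫ y, quantileScore α G₁ x.1 y ∂μ)
        + G₂ x.2 * (x.2 + ∫ y, quantileScore α (fun t => t / α) x.1 y ∂μ)
        - 𝒢₂ x.2 + ∫ y, a y ∂μ := by
    intro μ hμ x
    have := hprob μ hμ
    have h1 := integrable_quantileScore μ α (hG₁int x.1 μ hμ)
    have h2 := integrable_quantileScore μ α (hdivint μ hμ x.1)
    have h3 : Integrable
        (fun y => G₂ x.2 * (x.2 + quantileScore α (fun t => t / α) x.1 y)) μ :=
      ((integrable_const x.2).add h2).const_mul (G₂ x.2)
    have h4 : Integrable (fun y => quantileScore α G₁ x.1 y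
        + G₂ x.2 * (x.2 + quantileScore α (fun t => t / α) x.1 y)) μ := h1.add h3
    have h5 : Integrable (fun y => quantileScore α G₁ x.1 y
        + G₂ x.2 * (x.2 + quantileScore α (fun t => t / α) x.1 y) - 𝒢₂ x.2) μ :=
      h4.sub (integrable_const _)
    simp_rw [varEsScore_eq hα0]
    rw [integral_add h5 (ha μ hμ), integral_sub h4 (integrable_const _), integral_add h1 h3,
      integral_const_mul, integral_add (integrable_const _) h2]
    simp
  have hvalT : ∀ μ ∈ 𝓕, ∫ y, varEsScore α G₁ G₂ 𝒢₂ a (T μ) y ∂μ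
      = (∫ y, quantileScore α G₁ (quantile μ α) y ∂μ) - 𝒢₂ (es μ α) + ∫ y, a y ∂μ := by
    intro μ hμ
    have := hprob μ hμ
    rw [hval μ hμ, hT μ hμ]
    simp only [integral_quantileScore_div μ (hmom μ hμ) hα]
    ring
  have hmem : ∀ μ ∈ 𝓕, cdfLeft μ (quantile μ α) ≤ α ∧ α ≤ cdf μ (quantile μ α) := by
    intro μ hμ
    have := hprob μ hμ
    exact (quantile_mem_of_uniqueQuantile μ hα (huniq μ hμ)).ge rfl
  have hG₁min : ∀ μ ∈ 𝓕, ∀ x, (∫ y, quantileScore α G₁ (quantile μ α) y ∂μ)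
      ≤ ∫ y, quantileScore α G₁ x y ∂μ := by
    intro μ hμ x
    have := hprob μ hμ
    exact integral_quantileScore_le μ hG₁ (fun x => hG₁int x μ hμ) (hmem μ hμ).1 (hmem μ hμ).2 x
  have hesmin : ∀ μ ∈ 𝓕, ∀ x,
      -es μ α ≤ ∫ y, quantileScore α (fun t => t / α) x y ∂μ := by
    intro μ hμ x
    have := hprob μ hμ
    rw [← integral_quantileScore_div μ (hmom μ hμ) hα]
    exact integral_quantileScore_le μ hdivmono.monotone (hdivint μ hμ)
      (hmem μ hμ).1 (hmem μ hμ).2 x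
  have hcons : IsConsistentScoring 𝓕 {x : ℝ × ℝ | x.2 ≤ x.1} T (varEsScore α G₁ G₂ 𝒢₂ a) := by
    refine ⟨fun μ hμ x _ => hint μ hμ x, fun μ hμ x _ => ?_⟩
    rw [hvalT μ hμ, hval μ hμ]
    have h1 := hG₁min μ hμ x.1
    have h2 := mul_le_mul_of_nonneg_left (hesmin μ hμ x.1) (hG₂nonneg x.2)
    have h3 := add_mul_sub_le_of_convexOn h𝒢₂conv (h𝒢₂ x.2) (es μ α)
    linarith
  refine ⟨hcons, fun ⟨hsm, hsc⟩ => ?_⟩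
  have hstrict :
      IsStrictlyConsistentScoring 𝓕 {x : ℝ × ℝ | x.2 ≤ x.1} T (varEsScore α G₁ G₂ 𝒢₂ a) := by
    refine ⟨hcons, fun μ hμ x _ heq => ?_⟩
    have := hprob μ hμ
    rw [hvalT μ hμ, hval μ hμ] at heq
    have h1 := hG₁min μ hμ x.1
    have h2 := mul_le_mul_of_nonneg_left (hesmin μ hμ x.1) (hG₂nonneg x.2)
    have h3 := add_mul_sub_le_of_convexOn h𝒢₂conv (h𝒢₂ x.2) (es μ α)
    have hx₂ : x.2 = es μ α := by
      by_contra hne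
      have := add_mul_sub_lt_of_strictConvexOn hsc (h𝒢₂ x.2) hne
      linarith
    have hG₂pos : 0 < G₂ x.2 := by
      refine lt_of_le_of_ne (hG₂nonneg x.2) fun h0 => ?_
      have h4 := add_mul_sub_le_of_convexOn h𝒢₂conv (h𝒢₂ x.2) (x.2 - 1)
      rw [← h0] at h4
      linarith [hsm (sub_one_lt x.2)]
    have hp : -es μ α = ∫ y, quantileScore α (fun t => t / α) x.1 y ∂μ :=
      mul_left_cancel₀ hG₂pos.ne' (by linarith)
    have hx₁ : x.1 = quantile μ α := by
      refine eq_of_integral_quantileScore_eq μ hdivmono (hdivint μ hμ)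
        (quantile_mem_of_uniqueQuantile μ hα (huniq μ hμ)) ?_
      rw [integral_quantileScore_div μ (hmom μ hμ) hα, hp]
    rw [hT μ hμ]
    exact Prod.ext hx₁ hx₂
  exact ⟨hstrict, _, hstrict⟩
end
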